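/- arXiv:1801.08765 — 2 statements merged into one kernel-verified Lean document; each statement's English description precedes it below -/
import Mathlib

section
/- Schanuel's conjecture implies the two-sorted Schanuel conjecture: if (SC) holds, then for every n and all complex numbers a₁,…,aₙ, trdeg_ℚ(a₁,…,aₙ) + trdeg_ℚ(exp a₁,…,exp aₙ) ≥ dim_ℚ span_ℚ{a₁,…,aₙ}. -/
set_option maxHeartbeats 1000000
set_option synthInstance.maxHeartbeats 400000

/-- Transcendence degree of an algebra extension. -/
noncomputable def trdeg (F E : Type*) [CommRing F] [CommRing E] [Algebra F E] : Cardinal :=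
  ⨆ s : { s : Set E // AlgebraicIndependent F ((↑) : s → E) }, Cardinal.mk s.1

/-- Schanuel's conjecture: for all `ℚ`-linearly independent complex numbers
`a₁,…,aₙ`, the transcendence degree of `ℚ(a₁, exp a₁, …, aₙ, exp aₙ)` over `ℚ`
is at least `n`. -/
def SchanuelConjecture : Prop :=
  ∀ (n : ℕ) (a : Fin n → ℂ), LinearIndependent ℚ a →
    (n : Cardinal) ≤ trdeg ℚ (IntermediateField.adjoin ℚ
      (Set.range a ∪ Set.range fun i => Complex.exp (a i)))

section

open AlgebraicIndependent

variable {F K : Type*} [Field F] [Field K] [Algebra F K]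

/-- The field generated by `S` lies in the algebraic-matroid closure of `S`. -/
theorem adjoin_subset_matroid_closure (S : Set K) :
    (IntermediateField.adjoin F S : Set K) ⊆ (matroid F K).closure S := by
  rw [matroid_closure_eq]
  intro x hx
  have hx' : IsAlgebraic (IntermediateField.adjoin F S) x :=
    isAlgebraic_algebraMap (⟨x, hx⟩ : IntermediateField.adjoin F S)
  exact IntermediateField.isAlgebraic_adjoin_iff.mp hx'

/-- The transcendence degree of the field generated by `S` is the rank of `S` in the
algebraic matroid. -/
theorem trdeg_adjoin_eq_cRk (S : Set K) :
    trdeg F (IntermediateField.adjoin F S) = (matroid F K).cRk S := by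
  apply le_antisymm
  · refine ciSup_le' fun ⟨s, hs⟩ => ?_
    have hind : (matroid F K).Indep (Subtype.val '' s) :=
      matroid_indep_iff.mpr
        (AlgebraicIndependent.image (f := Subtype.val) (s := s)
          (hs.map' (f := (IntermediateField.adjoin F S).val) Subtype.val_injective))
    rw [← Matroid.cRk_closure, ← Cardinal.mk_image_eq (s := s) Subtype.val_injective]
    refine hind.cardinalMk_le_cRk_of_subset (Set.Subset.trans ?_ (adjoin_subset_matroid_closure S))
    rintro _ ⟨y, -, rfl⟩
    exact y.2
  · refine Matroid.cRk_le_iff.mpr fun I hI => ?_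
    let f : I → IntermediateField.adjoin F S :=
      fun i => ⟨i, IntermediateField.subset_adjoin F S (hI.subset i.2)⟩
    have hf : AlgebraicIndependent F f :=
      AlgebraicIndependent.of_comp (IntermediateField.adjoin F S).val
        (matroid_indep_iff.mp hI.indep)
    rw [← Cardinal.mk_range_eq f hf.injective]
    exact le_ciSup (f := fun s : { s : Set (IntermediateField.adjoin F S) //
      AlgebraicIndependent F ((↑) : s → IntermediateField.adjoin F S) } => Cardinal.mk s.1)
      Cardinal.bddAbove_of_small ⟨_, hf.to_subtype_range⟩

theorem trdeg_adjoin_mono {S T : Set K} (h : S ⊆ T) :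
    trdeg F (IntermediateField.adjoin F S) ≤ trdeg F (IntermediateField.adjoin F T) := by
  simpa only [trdeg_adjoin_eq_cRk] using (matroid F K).cRk_mono h

theorem trdeg_adjoin_union_le (S T : Set K) :
    trdeg F (IntermediateField.adjoin F (S ∪ T)) ≤
      trdeg F (IntermediateField.adjoin F S) + trdeg F (IntermediateField.adjoin F T) := by
  simp only [trdeg_adjoin_eq_cRk]
  exact le_add_self.trans (Matroid.cRk_inter_add_cRk_union_le (matroid F K) S T)

end

/-- **Schanuel's conjecture implies the two-sorted Schanuel conjecture:**
`trdeg_ℚ(a₁,…,aₙ) + trdeg_ℚ(exp a₁,…,exp aₙ) ≥ dim_ℚ span_ℚ {a₁,…,aₙ}`. -/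
theorem sc_implies_two_sorted_sc (hSC : SchanuelConjecture) :
    ∀ (n : ℕ) (a : Fin n → ℂ),
      Module.rank ℚ (Submodule.span ℚ (Set.range a))
        ≤ trdeg ℚ (IntermediateField.adjoin ℚ (Set.range a))
          + trdeg ℚ (IntermediateField.adjoin ℚ
              (Set.range fun i => Complex.exp (a i))) := by
  intro n a
  obtain ⟨κ, e, he, hspan, hli⟩ := exists_linearIndependent' ℚ a
  have : Finite κ := Finite.of_injective e he
  let σ := Finite.equivFin κ
  have hli' : LinearIndependent ℚ (a ∘ e ∘ σ.symm) := hli.comp σ.symm σ.symm.injective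
  have hrank : Module.rank ℚ (Submodule.span ℚ (Set.range a)) = (Nat.card κ : Cardinal) := by
    rw [← hspan, rank_span hli, Cardinal.mk_range_eq _ hli.injective, Nat.cast_card]
  rw [hrank]
  refine (hSC _ _ hli').trans ((trdeg_adjoin_mono ?_).trans (trdeg_adjoin_union_le _ _))
  apply Set.union_subset_union
  · exact Set.range_comp_subset_range (e ∘ σ.symm) a
  · exact Set.range_comp_subset_range (e ∘ σ.symm) fun i => Complex.exp (a i)
end

section
/- (SC implies SCP_gen). Assume Schanuel's conjecture (SC). Let ρ ∈ ℂ be not exponentially algebraic in ℂ_exp, and let a₁, b₁, …, aₙ, bₙ ∈ ℂ be such that each bᵢ is a value of aᵢ^ρ. If a₁, b₁, …, aₙ, bₙ are multiplicatively independent, then trdeg_ℚ(a₁, b₁, …, aₙ, bₙ) ≥ n. -/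
set_option maxHeartbeats 1000000
set_option synthInstance.maxHeartbeats 400000

/-- Membership in the smallest subring of functions `ℂⁿ → ℂ` containing the
coordinate projections and closed under `f ↦ exp ∘ f` (exponential polynomials). -/
inductive IsExpPoly {n : ℕ} : ((Fin n → ℂ) → ℂ) → Prop
  | proj (i : Fin n) : IsExpPoly fun x => x i
  | zero : IsExpPoly 0
  | one : IsExpPoly 1
  | neg {f} : IsExpPoly f → IsExpPoly (-f)
  | add {f g} : IsExpPoly f → IsExpPoly g → IsExpPoly (f + g)
  | mul {f g} : IsExpPoly f → IsExpPoly g → IsExpPoly (f * g)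
  | exp {f} : IsExpPoly f → IsExpPoly fun x => Complex.exp (f x)

/-- A complex number `γ` is exponentially algebraic in `ℂ_exp` iff there are `n ≥ 1`,
a point `a ∈ ℂⁿ` with first coordinate `γ`, and exponential polynomials `f₁,…,fₙ`
vanishing at `a` whose Jacobian determinant at `a` is nonzero. -/
def ExpAlgebraic (γ : ℂ) : Prop :=
  ∃ (n : ℕ) (hn : 0 < n) (a : Fin n → ℂ) (f : Fin n → (Fin n → ℂ) → ℂ),
    a ⟨0, hn⟩ = γ ∧ (∀ i, IsExpPoly (f i)) ∧ (∀ i, f i a = 0) ∧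
    (Matrix.of fun i j => fderiv ℂ (f i) a (Pi.single j 1)).det ≠ 0

/-- Derivations extend along formally étale algebras. -/
theorem Derivation.exists_extension_of_formallyEtale {R S T M : Type*} [CommRing R] [CommRing S]
    [CommRing T] [Algebra R S] [Algebra R T] [Algebra S T] [IsScalarTower R S T]
    [Algebra.FormallyEtale S T] [AddCommGroup M] [Module R M] [Module S M] [Module T M]
    [IsScalarTower R S M] [IsScalarTower R T M] [IsScalarTower S T M] (d : Derivation R S M) :
    ∃ d' : Derivation R T M, ∀ s, d' (algebraMap S T s) = d s := by
  let e := KaehlerDifferential.tensorKaehlerEquivOfFormallyEtale R S T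
  let l : TensorProduct S T (KaehlerDifferential R S) →ₗ[T] M :=
    LinearMap.liftBaseChange T d.liftKaehlerDifferential
  refine ⟨(l ∘ₗ e.symm.toLinearMap).compDer (KaehlerDifferential.D R T), fun s => ?_⟩
  have h := KaehlerDifferential.tensorKaehlerEquivOfFormallyEtale_symm_D_algebraMap R S T s
  change l (e.symm (KaehlerDifferential.D R T (algebraMap S T s))) = d s
  rw [h]
  simp [l]

theorem Derivation.eq_zero_of_isAlgebraic {C K M : Type*} [Field C] [Field K] [CharZero C]
    [Algebra C K] [AddCommGroup M] [Module C M] [Module K M]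
    (d : Derivation C K M) {x : K} (hx : IsAlgebraic C x) : d x = 0 := by
  have h1 : Polynomial.aeval x (minpoly C x) = 0 := minpoly.aeval C x
  have h2 := d.map_aeval (minpoly C x) x
  rw [h1, map_zero] at h2
  have h3 : Polynomial.aeval x (Polynomial.derivative (minpoly C x)) ≠ 0 :=
    (minpoly.irreducible hx.isIntegral).separable.aeval_derivative_ne_zero h1
  exact (smul_eq_zero.mp h2.symm).resolve_left h3

theorem Derivation.map_prod_div_prod {R K ι : Type*} [CommRing R] [Field K] [Algebra R K]
    (d : Derivation R K K) (s : Finset ι) (f : ι → K) (hf : ∀ i ∈ s, f i ≠ 0) :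
    d (∏ i ∈ s, f i) / ∏ i ∈ s, f i = ∑ i ∈ s, d (f i) / f i := by
  classical
  induction s using Finset.induction_on with
  | empty => simp
  | insert a s ha ih =>
    have h1 : f a ≠ 0 := hf a (by simp)
    have h2 : ∏ i ∈ s, f i ≠ 0 := Finset.prod_ne_zero_iff.mpr fun i hi => hf i (by simp [hi])
    rw [Finset.prod_insert ha, Finset.sum_insert ha, ← ih fun i hi => hf i (by simp [hi]),
      d.leibniz, smul_eq_mul, smul_eq_mul]
    field_simp
    ring

theorem Derivation.map_zpow_div {R K : Type*} [CommRing R] [Field K] [Algebra R K]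
    (d : Derivation R K K) {x : K} (hx : x ≠ 0) (n : ℤ) : d (x ^ n) / x ^ n = n * (d x / x) := by
  rw [d.leibniz_zpow, zpow_sub_one₀ hx, zsmul_eq_mul, smul_eq_mul]
  field_simp

section Trace

variable {F M K : Type*} [Field F] [Field M] [Field K] [CharZero M] [Algebra F M] [Algebra F K]
  [Algebra M K] [FiniteDimensional M K]

/-- Trace commutes with derivations, and turns logarithmic derivatives into logarithmic
derivatives of norms. -/
theorem Derivation.trace_and_logDeriv (δ₀ : Derivation F M M) (δ : Derivation F K K)
    (h : ∀ m, δ (algebraMap M K m) = algebraMap M K (δ₀ m)) :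
    (∀ w, Algebra.trace M K (δ w) = δ₀ (Algebra.trace M K w)) ∧
    ∀ y, y ≠ 0 → Algebra.trace M K (δ y / y) =
      δ₀ (Algebra.norm M y) / Algebra.norm M y := by
  let Ω := AlgebraicClosure M
  have : Algebra.FormallyEtale M Ω := Algebra.FormallyEtale.of_isSeparable M Ω
  obtain ⟨δΩ, hΩ⟩ := Derivation.exists_extension_of_formallyEtale (T := Ω)
    (((Algebra.linearMap M Ω).compDer δ₀ : Derivation F M Ω))
  replace hΩ : ∀ m, δΩ (algebraMap M Ω m) = algebraMap M Ω (δ₀ m) := hΩ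
  have key : ∀ (σ : K →ₐ[M] Ω) (w : K), σ (δ w) = δΩ (σ w) := by
    intro σ w
    let _ : Algebra K Ω := σ.toRingHom.toAlgebra
    have hσ : ∀ (k : K) (o : Ω), k • o = σ k * o := fun _ _ => rfl
    let d : Derivation M K Ω := Derivation.mk'
      { toFun := fun x => σ (δ x) - δΩ (σ x)
        map_add' := fun x y => by simp only [map_add]; abel
        map_smul' := fun m x => by
          simp only [Algebra.smul_def, Derivation.leibniz, map_mul, map_add, h, RingHom.id_apply,
            Algebra.algebraMap_self, AlgHom.commutes, hΩ]
          ring }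
      (fun x y => by
        simp only [LinearMap.coe_mk, AddHom.coe_mk, Derivation.leibniz, map_mul, map_add,
          smul_eq_mul, hσ]
        ring)
    exact sub_eq_zero.mp (d.eq_zero_of_isAlgebraic (Algebra.IsAlgebraic.isAlgebraic w))
  have inj := (algebraMap M Ω).injective
  refine ⟨fun w => inj ?_, fun y hy => inj ?_⟩
  · rw [← hΩ, trace_eq_sum_embeddings Ω, trace_eq_sum_embeddings Ω, map_sum]
    exact Finset.sum_congr rfl fun σ _ => key σ w
  · rw [map_div₀ (algebraMap M Ω), ← hΩ, trace_eq_sum_embeddings Ω,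
      Algebra.norm_eq_prod_embeddings M Ω, Derivation.map_prod_div_prod _ _ _ fun σ _ => by simpa using hy]
    exact Finset.sum_congr rfl fun σ _ => by rw [map_div₀, key]

end Trace

section Residue

open LaurentSeries

theorem exists_derivation_extension {S T : Type*} [CommRing S] [CommRing T] [Algebra S T]
    [Algebra.FormallyEtale S T] (d : S →+ S) (hd : ∀ a b, d (a * b) = a * d b + b * d a) :
    ∃ d' : Derivation ℤ T T, ∀ s, d' (algebraMap S T s) = algebraMap S T (d s) :=
  Derivation.exists_extension_of_formallyEtale
    ((Algebra.linearMap S T).compDer (Derivation.mk' d.toIntLinearMap hd))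

theorem exists_additive_derivation_extension {S T : Type*} [CommRing S] [CommRing T] [Algebra S T]
    [Algebra.FormallyEtale S T] (d : S →+ S) (hd : ∀ a b, d (a * b) = a * d b + b * d a) :
    ∃ d' : T →+ T, (∀ a b, d' (a * b) = a * d' b + b * d' a) ∧
      ∀ s, d' (algebraMap S T s) = algebraMap S T (d s) := by
  obtain ⟨d', h⟩ := exists_derivation_extension (T := T) d hd
  exact ⟨d'.toLinearMap.toAddMonoidHom, d'.leibniz, h⟩

/-- The derivative and the residue at `0` on rational functions. -/
theorem RatFunc.exists_derivation_residue (F : Type*) [Field F] :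
    ∃ (δ : Derivation F (RatFunc F) (RatFunc F)) (res : RatFunc F →ₗ[F] F),
      δ RatFunc.X = 1 ∧ (∀ f, res (δ f) = 0) ∧ (∀ f ≠ 0, ∃ r : ℤ, res (δ f / f) = r) ∧
      res (RatFunc.X)⁻¹ = 1 := by
  have : Algebra.FormallyEtale (Polynomial F) (RatFunc F) :=
    Algebra.FormallyEtale.of_isLocalization (nonZeroDivisors (Polynomial F))
  obtain ⟨δ, hδ⟩ := Derivation.exists_extension_of_formallyEtale (T := RatFunc F)
    ((Algebra.linearMap (Polynomial F) (RatFunc F)).compDer Polynomial.derivative')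
  replace hδ : ∀ p, δ (algebraMap _ _ p) = algebraMap _ _ (Polynomial.derivative p) := hδ
  let ι : PowerSeries F →+* F⸨X⸩ := HahnSeries.ofPowerSeries ℤ F
  have : Algebra.FormallyEtale (PowerSeries F) (F⸨X⸩) :=
    Algebra.FormallyEtale.of_isLocalization (nonZeroDivisors (PowerSeries F))
  obtain ⟨dL, hL, hdL⟩ := exists_additive_derivation_extension (T := F⸨X⸩)
    (PowerSeries.derivative F).toLinearMap.toAddMonoidHom (PowerSeries.derivative F).leibniz
  replace hdL : ∀ p, dL (ι p) = ι (PowerSeries.derivative F p) := hdL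
  let φ : RatFunc F →+* F⸨X⸩ := algebraMap _ _
  have hφp : ∀ p : Polynomial F, φ (algebraMap _ _ p) = ι (p : PowerSeries F) := by
    intro p
    exact (RatFunc.coe_coe p).symm
  have hpoly : ∀ p : Polynomial F, φ (δ (algebraMap _ _ p)) = dL (φ (algebraMap _ _ p)) := by
    intro p
    rw [hδ, hφp, hφp, hdL, PowerSeries.derivative_coe]
  have hφ : ∀ f, φ (δ f) = dL (φ f) := by
    intro f
    induction f using RatFunc.induction_on with
    | f p q hq =>
      have hq' : algebraMap (Polynomial F) (RatFunc F) q ≠ 0 := by simpa using hq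
      have h1 := hL (φ (algebraMap _ _ p / algebraMap _ _ q)) (φ (algebraMap _ _ q))
      have h2 := δ.leibniz (algebraMap _ _ p / algebraMap _ _ q) (algebraMap _ _ q)
      have h3 : φ (algebraMap _ _ q) ≠ 0 := by simpa using hq
      have h4 : φ (δ (algebraMap _ _ q)) = dL (φ (algebraMap _ _ q)) := hpoly q
      rw [← map_mul, div_mul_cancel₀ _ hq', ← hpoly] at h1
      rw [div_mul_cancel₀ _ hq'] at h2
      rw [h2] at h1
      simp only [smul_eq_mul, map_add, map_mul, h4] at h1
      exact mul_left_cancel₀ h3 (add_left_cancel h1)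
  have hcoeff : ∀ (p : PowerSeries F) (k m : ℤ),
      (HahnSeries.single k 1 * ι p : F⸨X⸩).coeff m = (ι p).coeff (m - k) := by
    intro p k m
    simp [HahnSeries.coeff_single_mul]
  have hX' : ∀ k : ℤ, dL (HahnSeries.single k 1) = HahnSeries.single (k - 1) (k : F) := by
    have hnat : ∀ k : ℕ, dL (HahnSeries.single (k : ℤ) 1) =
        HahnSeries.single ((k : ℤ) - 1) (k : F) := by
      intro k
      have h1 : (HahnSeries.single (k : ℤ) 1 : F⸨X⸩) = ι (PowerSeries.X ^ k) :=
        (HahnSeries.ofPowerSeries_X_pow k).symm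
      rw [h1, hdL, Derivation.leibniz_pow]
      cases k with
      | zero => simp
      | succ k =>
        simp only [PowerSeries.derivative_X, Nat.add_sub_cancel, smul_eq_mul, mul_one,
          nsmul_eq_mul, map_mul, map_natCast]
        rw [show ι (PowerSeries.X ^ k) = HahnSeries.single (k : ℤ) 1 from
          HahnSeries.ofPowerSeries_X_pow k]
        rw [← map_natCast (HahnSeries.C : F →+* F⸨X⸩) (k + 1), HahnSeries.C_apply,
          HahnSeries.single_mul_single]
        simp
    have hneg : ∀ k : ℕ, dL (HahnSeries.single (-(k : ℤ)) 1) =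
        HahnSeries.single (-(k : ℤ) - 1) (-(k : F)) := by
      intro k
      have h1 := hL (HahnSeries.single (-(k : ℤ)) 1) (HahnSeries.single (k : ℤ) 1)
      have h2 : dL 1 = 0 := by simpa using hL 1 1
      rw [HahnSeries.single_mul_single, hnat, HahnSeries.single_mul_single, neg_add_cancel,
        mul_one, HahnSeries.single_zero_one, h2] at h1
      have h3 := congrArg (fun z : F⸨X⸩ => HahnSeries.single (-(k : ℤ)) 1 * z) h1.symm
      simp only [mul_add, mul_zero, ← mul_assoc, HahnSeries.single_mul_single, neg_add_cancel,
        mul_one, one_mul, HahnSeries.single_zero_one] at h3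
      rw [eq_neg_of_add_eq_zero_right h3, ← HahnSeries.single_neg]
      congr 1
      ring_nf
    intro k
    obtain ⟨j, rfl | rfl⟩ := Int.eq_nat_or_neg k
    · simpa using hnat j
    · simpa using hneg j
  have hι : ∀ (p : PowerSeries F) (m : ℤ),
      (ι (PowerSeries.derivative F p)).coeff m = (m + 1) * (ι p).coeff (m + 1) := by
    intro p m
    simp only [ι, PowerSeries.coeff_coe]
    rcases lt_trichotomy m (-1) with h | rfl | h
    · rw [if_pos (by lia), if_pos (by lia), mul_zero]
    · simp
    · rw [if_neg (by lia), if_neg (by lia), PowerSeries.coeff_derivative]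
      lift m to ℕ using (by lia)
      rw [show (m : ℤ).natAbs = m by simp, show ((m : ℤ) + 1).natAbs = m + 1 by lia, mul_comm]
      simp
  have hdec : ∀ f : F⸨X⸩, ∃ (p : PowerSeries F), f = HahnSeries.single f.order 1 * ι p ∧
    (f ≠ 0 → PowerSeries.constantCoeff p ≠ 0) := by
    intro f
    refine ⟨f.powerSeriesPart, (LaurentSeries.single_order_mul_powerSeriesPart f).symm,
      fun hf => ?_⟩
    rw [← PowerSeries.coeff_zero_eq_constantCoeff_apply, LaurentSeries.powerSeriesPart_coeff]
    simpa using hf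
  have hder : ∀ f : F⸨X⸩, (dL f).coeff (-1) = 0 := by
    intro f
    obtain ⟨p, hp, -⟩ := hdec f
    rw [hp, hL, hX', hdL, HahnSeries.coeff_add, hcoeff, hι, mul_comm (ι p),
      HahnSeries.coeff_single_mul, show (-1 : ℤ) - f.order + 1 = -1 - (f.order - 1) by ring]
    push_cast
    ring
  have hlog : ∀ f : F⸨X⸩, f ≠ 0 → (dL f / f).coeff (-1) = f.order := by
    intro f hf
    obtain ⟨p, hp, hp0⟩ := hdec f
    have hpu : p * p⁻¹ = 1 := PowerSeries.mul_inv_cancel p (hp0 hf)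
    have hpu' : ι p * ι p⁻¹ = 1 := by rw [← map_mul, hpu, map_one]
    have h1 : dL f / f = ι (PowerSeries.derivative F p * p⁻¹) +
        HahnSeries.single (-1) (f.order : F) := by
      rw [div_eq_iff hf]
      have h2 : HahnSeries.single (f.order - 1) (f.order : F) =
          (HahnSeries.single (-1) (f.order : F) : F⸨X⸩) * HahnSeries.single f.order 1 := by
        rw [HahnSeries.single_mul_single, mul_one, sub_eq_neg_add]
      have h3 : dL f = HahnSeries.single f.order 1 * ι (PowerSeries.derivative F p) +
          ι p * HahnSeries.single (f.order - 1) (f.order : F) := by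
        conv_lhs => rw [hp, hL, hX', hdL]
      rw [h3, h2]
      generalize HahnSeries.single (-1) (f.order : F) = u at *
      conv_rhs => rw [hp]
      rw [map_mul]
      linear_combination (-(HahnSeries.single f.order 1 : F⸨X⸩) *
        ι (PowerSeries.derivative F p)) * hpu'
    rw [h1, HahnSeries.coeff_add, HahnSeries.coeff_single_same]
    simp only [ι, PowerSeries.coeff_coe]
    simp
  let res : RatFunc F →ₗ[F] F :=
    { toFun := fun f => (φ f).coeff (-1)
      map_add' := fun f g => by simp
      map_smul' := fun c f => by
        have h1 : φ (algebraMap F (RatFunc F) c) = HahnSeries.single 0 c := by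
          rw [IsScalarTower.algebraMap_apply F (Polynomial F) (RatFunc F), hφp]
          simp [ι]
        rw [Algebra.smul_def, map_mul, h1, HahnSeries.coeff_single_mul]
        simp }
  refine ⟨δ, res, ?_, ?_, ?_, ?_⟩
  · have := hδ Polynomial.X
    simpa using this
  · intro f
    change (φ (δ f)).coeff (-1) = 0
    rw [hφ, hder]
  · intro f hf
    refine ⟨(φ f).order, ?_⟩
    change (φ (δ f / f)).coeff (-1) = _
    rw [map_div₀, hφ, hlog _ (by simpa using hf)]
  · change (φ (RatFunc.X)⁻¹).coeff (-1) = 1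
    simp [φ]

end Residue

theorem IsAlgebraic.of_range_subset {A A' K : Type*} [CommRing A] [CommRing A'] [CommRing K]
    [Algebra A K] [Algebra A' K] [FaithfulSMul A K]
    (h : Set.range (algebraMap A K) ⊆ Set.range (algebraMap A' K)) {x : K}
    (hx : IsAlgebraic A x) : IsAlgebraic A' x := by
  obtain ⟨p, hp0, hp⟩ := hx
  obtain ⟨q, hq⟩ := (Polynomial.lifts_iff_coeff_lifts (f := algebraMap A' K)
    (p.map (algebraMap A K))).mpr fun n => by
      rw [Polynomial.coeff_map]
      exact h ⟨_, rfl⟩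
  replace hq : q.map (algebraMap A' K) = p.map (algebraMap A K) := hq
  refine ⟨q, fun h0 => hp0 ?_, ?_⟩
  · rw [h0, Polynomial.map_zero] at hq
    exact (Polynomial.map_eq_zero_iff (FaithfulSMul.algebraMap_injective A K)).mp hq.symm
  · rw [Polynomial.aeval_def, ← Polynomial.eval_map] at hp ⊢
    rwa [hq]

open scoped RatFunc in
/-- A residue functional on an algebraic function field `K / F` of one variable, of nonzero value
at the logarithmic derivative of a given transcendental element `Y`. -/
theorem exists_residue_of_transcendental {F K : Type*} [Field F] [Field K] [CharZero F]
    [Algebra F K] [Algebra.EssFiniteType F K] (Y : K) (hY : Transcendental F Y)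
    (halg : Algebra.IsAlgebraic (IntermediateField.adjoin F {Y}) K) :
    ∃ (Δ : Derivation F K K) (Λ : K →ₗ[F] F), (∀ v, Λ (Δ v) = 0) ∧
      (∀ y ≠ 0, ∃ r : ℤ, Λ (Δ y / y) = r) ∧ Λ (Δ Y / Y) ≠ 0 := by
  let _ : Algebra (Polynomial F) K := (Polynomial.aeval (R := F) Y).toRingHom.toAlgebra
  have hmap : ∀ p, algebraMap (Polynomial F) K p = Polynomial.aeval Y p := fun _ => rfl
  have : IsScalarTower F (Polynomial F) K := IsScalarTower.of_algebraMap_eq fun c => by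
    rw [hmap]; simp
  have : FaithfulSMul (Polynomial F) K := (faithfulSMul_iff_algebraMap_injective _ _).mpr
    (transcendental_iff_injective.mp hY)
  have : IsScalarTower F (RatFunc F) K := IsScalarTower.of_algebraMap_eq fun c => by
    rw [IsScalarTower.algebraMap_apply F (Polynomial F) K,
      IsScalarTower.algebraMap_apply F (Polynomial F) (RatFunc F),
      ← IsScalarTower.algebraMap_apply (Polynomial F) (RatFunc F) K]
  have hXY : algebraMap (RatFunc F) K RatFunc.X = Y := by
    rw [← RatFunc.algebraMap_X, ← IsScalarTower.algebraMap_apply (Polynomial F) (RatFunc F) K,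
      hmap, Polynomial.aeval_X]
  have : Algebra.EssFiniteType (RatFunc F) K := Algebra.EssFiniteType.of_comp F _ _
  have hYmem : IntermediateField.adjoin F {Y} ≤ (IsScalarTower.toAlgHom F (RatFunc F) K).fieldRange := by
    rw [IntermediateField.adjoin_simple_le_iff]
    exact ⟨RatFunc.X, hXY⟩
  have : Algebra.IsAlgebraic (RatFunc F) K := ⟨fun x =>
    (halg.isAlgebraic x).of_range_subset (Set.range_subset_iff.mpr fun e => hYmem e.2)⟩
  have : FiniteDimensional (RatFunc F) K := Algebra.finite_of_essFiniteType_of_isAlgebraic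
  have : CharZero (RatFunc F) := charZero_of_injective_algebraMap (algebraMap F _).injective
  have : Algebra.FormallyEtale (RatFunc F) K := Algebra.FormallyEtale.of_isSeparable _ _
  obtain ⟨δ₀, res, hδX, hres, hlog, hresX⟩ := RatFunc.exists_derivation_residue F
  obtain ⟨δ, hδ⟩ := Derivation.exists_extension_of_formallyEtale (T := K)
    ((Algebra.linearMap (RatFunc F) K).compDer δ₀)
  replace hδ : ∀ m, δ (algebraMap _ K m) = algebraMap _ K (δ₀ m) := hδ
  obtain ⟨htr, hnorm⟩ := Derivation.trace_and_logDeriv δ₀ δ hδ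
  refine ⟨δ, res ∘ₗ (Algebra.trace (RatFunc F) K).restrictScalars F, fun v => ?_, fun y hy => ?_,
    ?_⟩
  · change res (Algebra.trace _ K (δ v)) = 0
    rw [htr, hres]
  · obtain ⟨r, hr⟩ := hlog (Algebra.norm (RatFunc F) y) (Algebra.norm_ne_zero_iff.mpr hy)
    refine ⟨r, ?_⟩
    change res (Algebra.trace _ K (δ y / y)) = r
    rw [hnorm y hy, hr]
  · change res (Algebra.trace _ K (δ Y / Y)) ≠ 0
    have h1 : δ Y / Y = algebraMap (RatFunc F) K (RatFunc.X)⁻¹ := by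
      rw [map_inv₀, hXY, ← hXY, hδ, hδX, map_one, hXY, one_div]
    rw [h1, Algebra.trace_algebraMap, map_nsmul, hresX, nsmul_eq_mul, mul_one]
    exact Nat.cast_ne_zero.mpr Module.finrank_pos.ne'

theorem exists_residue {C K : Type*} [Field C] [Field K] [CharZero C] [Algebra C K]
    [Algebra.EssFiniteType C K] (Y : K) (hY : Transcendental C Y) :
    ∃ (F : IntermediateField C K) (Δ : Derivation C K K) (Λ : K →ₗ[C] F), (∀ v, Λ (Δ v) = 0) ∧
      (∀ y ≠ 0, ∃ r : ℤ, Λ (Δ y / y) = r) ∧ Λ (Δ Y / Y) ≠ 0 := by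
  obtain ⟨B, hYB, hB⟩ := exists_isTranscendenceBasis_superset (R := C) (s := {Y})
    (algebraicIndependent_unique_type_iff.mpr hY)
  rw [Set.singleton_subset_iff] at hYB
  let F := IntermediateField.adjoin C (B \ {Y})
  have hYF : Transcendental F Y := by
    have h1 : AlgebraicIndepOn C id (insert Y (B \ {Y})) := by
      rw [Set.insert_sdiff_singleton, Set.insert_eq_of_mem hYB]; exact hB.1
    have h2 := ((AlgebraicIndepOn.insert_iff (by simp)).mp h1).2
    rw [Set.image_id] at h2
    exact fun h3 => h2 (IntermediateField.isAlgebraic_adjoin_iff.mp h3)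
  have halg : Algebra.IsAlgebraic (IntermediateField.adjoin F {Y}) K := ⟨fun x => by
    refine (hB.isAlgebraic.isAlgebraic x).of_range_subset (Set.range_subset_iff.mpr fun e => ?_)
    have h1 : Algebra.adjoin C (Set.range ((↑) : B → K)) ≤
        ((IntermediateField.adjoin F {Y}).restrictScalars C).toSubalgebra := by
      rw [Algebra.adjoin_le_iff, Subtype.range_coe]
      intro z hz
      by_cases hzY : z = Y
      · exact IntermediateField.subset_adjoin F {Y} hzY
      · exact (IntermediateField.adjoin F {Y}).algebraMap_mem
          ⟨z, IntermediateField.subset_adjoin C _ ⟨hz, hzY⟩⟩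
    exact ⟨⟨_, h1 e.2⟩, rfl⟩⟩
  have : Algebra.EssFiniteType F K := Algebra.EssFiniteType.of_comp C _ _
  obtain ⟨Δ, Λ, h1, h2, h3⟩ := exists_residue_of_transcendental Y hYF halg
  exact ⟨F, Δ.restrictScalars C, Λ.restrictScalars C, h1, h2, h3⟩

/-- The field of constants of a derivation. -/
def Derivation.constants {F K : Type*} [Field F] [Field K] [Algebra F K] (D : Derivation F K K) :
    IntermediateField F K where
  carrier := {x | D x = 0}
  mul_mem' := fun {a b} (ha : D a = 0) (hb : D b = 0) => by simp [ha, hb]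
  add_mem' := fun {a b} (ha : D a = 0) (hb : D b = 0) => by simp [ha, hb]
  algebraMap_mem' := fun r => by simp
  inv_mem' := fun a (ha : D a = 0) => by simp [Derivation.leibniz_inv, ha]

theorem Derivation.mem_constants {F K : Type*} [Field F] [Field K] [Algebra F K]
    {D : Derivation F K K} {x : K} : x ∈ D.constants ↔ D x = 0 := Iff.rfl

/-- A derivation is linear over its field of constants. -/
def Derivation.overConstants {F K : Type*} [Field F] [Field K] [Algebra F K]
    (D : Derivation F K K) : Derivation D.constants K K :=
  Derivation.mk'
    { toFun := D
      map_add' := D.map_add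
      map_smul' := fun c x => by
        simp [Algebra.smul_def, Derivation.mem_constants.mp c.2] }
    D.leibniz

theorem exists_int_multiples {ι : Type*} [Fintype ι] (q : ι → ℚ) :
    ∃ (N : ℤ) (n : ι → ℤ), N ≠ 0 ∧ ∀ i, (n i : ℚ) = N * q i := by
  obtain ⟨b, hb⟩ := IsLocalization.exist_integer_multiples (nonZeroDivisors ℤ) Finset.univ q
  choose n hn using fun i => hb i (Finset.mem_univ i)
  refine ⟨b, n, nonZeroDivisors.coe_ne_zero b, fun i => ?_⟩
  simpa [Algebra.smul_def, Submonoid.smul_def] using hn i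

theorem Derivation.eq_zero_of_isTranscendenceBasis {C K : Type*} [Field C] [Field K] [CharZero C]
    [Algebra C K] {B : Set K} (hB : IsTranscendenceBasis C ((↑) : B → K))
    (Δ : Derivation C K K) (h : ∀ b ∈ B, Δ b = 0) : Δ = 0 := by
  ext x
  refine Δ.overConstants.eq_zero_of_isAlgebraic (x := x)
    ((hB.isAlgebraic.isAlgebraic x).of_range_subset (Set.range_subset_iff.mpr fun e => ?_))
  have h1 : Algebra.adjoin C (Set.range ((↑) : B → K)) ≤ Δ.constants.toSubalgebra := by
    rw [Algebra.adjoin_le_iff, Subtype.range_coe]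
    exact h
  exact ⟨⟨_, h1 e.2⟩, rfl⟩

theorem Derivation.finrank_le_of_trdeg_le {C K : Type*} [Field C] [Field K] [CharZero C]
    [Algebra C K] {k : ℕ} (h : Algebra.trdeg C K ≤ k) :
    FiniteDimensional K (Derivation C K K) ∧ Module.finrank K (Derivation C K K) ≤ k := by
  obtain ⟨B, hB⟩ := exists_isTranscendenceBasis C K
  rw [← hB.cardinalMk_eq_trdeg] at h
  have : Finite B := Cardinal.lt_aleph0_iff_finite.mp (h.trans_lt (Cardinal.natCast_lt_aleph0))
  have := Fintype.ofFinite B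
  let ev : Derivation C K K →ₗ[K] (B → K) :=
    { toFun := fun Δ b => Δ b
      map_add' := fun _ _ => rfl
      map_smul' := fun _ _ => rfl }
  have hev : Function.Injective ev := by
    refine (injective_iff_map_eq_zero ev).mpr fun Δ hΔ => ?_
    exact Δ.eq_zero_of_isTranscendenceBasis hB fun b hb => congrFun hΔ ⟨b, hb⟩
  refine ⟨FiniteDimensional.of_injective ev hev, ?_⟩
  refine (LinearMap.finrank_le_finrank_of_injective hev).trans ?_
  rw [Module.finrank_fintype_fun_eq_card]
  rw [Cardinal.mk_fintype] at h
  exact_mod_cast h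

/-- If the derivations fail to separate the logarithmic differentials `dyᵢ/yᵢ - dxᵢ`, then there is
a nontrivial relation between these with constant coefficients. -/
theorem Derivation.exists_constant_relation {C K : Type*} [Field C] [Field K]
    [Algebra C K] (D : Derivation C K K)
    {k : ℕ} (x y : Fin k → K) (hy : ∀ i, y i ≠ 0) (hxy : ∀ i, D (y i) = y i * D (x i))
    (hrel : ∃ c : Fin k → K, c ≠ 0 ∧
      ∀ Δ : Derivation C K K, ∑ i, c i * (Δ (y i) / y i - Δ (x i)) = 0) :
    ∃ c : Fin k → K, (∀ i, D (c i) = 0) ∧ (∃ i, c i = 1) ∧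
      ∀ Δ : Derivation C K K, ∑ i, c i * (Δ (y i) / y i - Δ (x i)) = 0 := by
  classical
  let P : (Fin k → K) → Prop := fun c => c ≠ 0 ∧
    ∀ Δ : Derivation C K K, ∑ i, c i * (Δ (y i) / y i - Δ (x i)) = 0
  let supp : (Fin k → K) → Finset (Fin k) := fun c => Finset.univ.filter fun i => c i ≠ 0
  obtain ⟨c, ⟨hc0, hc⟩, hmin⟩ :=
    (measure fun c => (supp c).card).wf.has_min {c | P c} hrel
  obtain ⟨i₀, hi₀⟩ := Function.ne_iff.mp hc0
  simp only [Pi.zero_apply] at hi₀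
  have hc' : ∀ Δ : Derivation C K K, ∑ i, c i / c i₀ * (Δ (y i) / y i - Δ (x i)) = 0 := by
    intro Δ
    have := congrArg (fun z => z / c i₀) (hc Δ)
    rw [Finset.sum_div, zero_div] at this
    rw [← this]
    exact Finset.sum_congr rfl fun i _ => by ring
  refine ⟨fun i => c i / c i₀, ?_, ⟨i₀, div_self hi₀⟩, hc'⟩
  by_contra! hne
  refine hmin (fun i => D (c i / c i₀)) ⟨Function.ne_iff.mpr hne, fun Δ => ?_⟩ ?_
  · have h1 := congrArg D (hc' Δ)
    rw [map_sum, map_zero] at h1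
    have h2 := hc' ⁅D, Δ⁆
    rw [← sub_eq_zero.mpr (h1.trans h2.symm), ← Finset.sum_sub_distrib]
    refine Finset.sum_congr rfl fun i _ => ?_
    have h3 : D (Δ (y i) / y i - Δ (x i)) = ⁅D, Δ⁆ (y i) / y i - ⁅D, Δ⁆ (x i) := by
      rw [Derivation.commutator_apply, Derivation.commutator_apply, hxy, map_sub,
        Derivation.leibniz_div, Derivation.leibniz, hxy]
      simp only [smul_eq_mul]
      have := hy i
      field_simp
      ring
    rw [Derivation.leibniz D (c i / c i₀) (_ - _), h3]
    simp only [smul_eq_mul]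
    ring
  · refine Finset.card_lt_card ((Finset.ssubset_iff_of_subset fun i hi => ?_).mpr
      ⟨i₀, by simpa [supp] using hi₀, by simp [supp, div_self hi₀]⟩)
    simp only [supp, Finset.mem_filter, Finset.mem_univ, true_and] at hi ⊢
    rintro h0
    simp [h0] at hi

/-- A form of Ax's theorem for a single derivation. -/
theorem Derivation.lt_trdeg_of_exponential {C K : Type*} [Field C] [Field K] [CharZero C]
    [Algebra C K] [Algebra.EssFiniteType C K] (D : Derivation C K K) (hD0 : D ≠ 0)
    (hD : ∀ z, D z = 0 → z ∈ Set.range (algebraMap C K)) {k : ℕ} (x y : Fin k → K)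
    (hy : ∀ i, y i ≠ 0) (hxy : ∀ i, D (y i) = y i * D (x i))
    (hli : ∀ n : Fin k → ℤ, ∑ i, n i * D (x i) = 0 → n = 0) :
    (k : Cardinal) < Algebra.trdeg C K := by
  by_contra! htr
  obtain ⟨_, hfin⟩ := Derivation.finrank_le_of_trdeg_le htr
  let Φ : Derivation C K K →ₗ[K] (Fin k → K) :=
    { toFun := fun Δ i => Δ (y i) / y i - Δ (x i)
      map_add' := fun Δ Δ' => by ext i; simp; ring
      map_smul' := fun c Δ => by ext i; simp; ring }
  have hΦD : Φ D = 0 := by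
    ext i
    change D (y i) / y i - D (x i) = 0
    rw [hxy, mul_div_cancel_left₀ _ (hy i), sub_self]
  have hrange : LinearMap.range Φ < ⊤ := by
    rw [lt_top_iff_ne_top]
    intro htop
    have h1 := LinearMap.finrank_range_add_finrank_ker Φ
    rw [htop, finrank_top, Module.finrank_fin_fun] at h1
    have h2 : LinearMap.ker Φ = ⊥ := Submodule.finrank_eq_zero.mp (by lia)
    exact hD0 ((Submodule.eq_bot_iff _).mp h2 D hΦD)
  obtain ⟨f, hf0, hf⟩ := Submodule.exists_le_ker_of_lt_top _ hrange
  have hfc : ∀ v, f v = ∑ i, f (Pi.single i 1) * v i := fun v => by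
    conv_lhs => rw [pi_eq_sum_univ' v, map_sum]
    refine Finset.sum_congr rfl fun i _ => ?_
    rw [_root_.map_smul, smul_eq_mul, mul_comm]
  obtain ⟨c, hcD, ⟨i₀, hi₀⟩, hc⟩ := D.exists_constant_relation x y hy hxy
    ⟨fun i => f (Pi.single i 1), fun h0 => hf0 (LinearMap.ext fun v => by
      rw [hfc]; simp only [congrFun h0]; simp), fun Δ => by
      rw [← hfc fun i => Δ (y i) / y i - Δ (x i)]
      exact hf ⟨Δ, rfl⟩⟩
  choose γ hγ using fun i => hD (c i) (hcD i)
  obtain ⟨ψ, hψ⟩ : ∃ ψ : C →ₗ[ℚ] ℚ, ψ 1 ≠ 0 := by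
    by_contra! h
    exact one_ne_zero ((Module.forall_dual_apply_eq_zero_iff ℚ (1 : C)).mp h)
  obtain ⟨N, m, hN, hm⟩ := exists_int_multiples fun i => ψ (γ i)
  have hγ₀ : γ i₀ = 1 := (algebraMap C K).injective (by rw [hγ, hi₀, map_one])
  have hm0 : m ≠ 0 := fun h => by
    have := hm i₀
    rw [hγ₀, h] at this
    simp only [Pi.zero_apply, Int.cast_zero] at this
    exact mul_ne_zero (Int.cast_ne_zero.mpr hN) hψ this.symm
  let Y : K := ∏ i, y i ^ m i
  have hY0 : Y ≠ 0 := Finset.prod_ne_zero_iff.mpr fun i _ => zpow_ne_zero _ (hy i)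
  have hYlog : ∀ Δ : Derivation C K K, Δ Y / Y = ∑ i, m i * (Δ (y i) / y i) := by
    intro Δ
    rw [Derivation.map_prod_div_prod _ _ _ fun i _ => zpow_ne_zero _ (hy i)]
    exact Finset.sum_congr rfl fun i _ => Δ.map_zpow_div (hy i) _
  have hYtr : Transcendental C Y := by
    intro h
    refine hm0 (hli m ?_)
    have h1 := hYlog D
    rw [D.eq_zero_of_isAlgebraic h, zero_div] at h1
    rw [h1]
    exact Finset.sum_congr rfl fun i _ => by rw [hxy, mul_div_cancel_left₀ _ (hy i)]
  obtain ⟨F, Δ, Λ, hΛ, hΛlog, hΛY⟩ := exists_residue Y hYtr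
  choose r hr using fun i => hΛlog (y i) (hy i)
  have h1 : ∑ i, γ i • (r i : F) = 0 := by
    have h2 : ∑ i, γ i • (Δ (y i) / y i) = Δ (∑ i, γ i • x i) := by
      rw [map_sum, ← sub_eq_zero, ← Finset.sum_sub_distrib, ← hc Δ]
      refine Finset.sum_congr rfl fun i _ => ?_
      rw [map_smul, ← smul_sub, Algebra.smul_def, hγ]
    have h3 := congrArg Λ h2
    rw [hΛ, map_sum] at h3
    rw [← h3]
    exact Finset.sum_congr rfl fun i _ => by rw [_root_.map_smul, hr]
  have h4 : ∑ i, (r i : ℚ) • γ i = 0 := by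
    apply (algebraMap C F).injective
    rw [map_zero, map_sum, ← h1]
    refine Finset.sum_congr rfl fun i _ => ?_
    rw [Algebra.smul_def, Algebra.smul_def, map_mul, mul_comm]
    simp
  have h5 : ∑ i, r i * m i = 0 := by
    have h6 := congrArg ψ h4
    rw [map_sum, map_zero] at h6
    have h7 : ((∑ i, r i * m i : ℤ) : ℚ) = N * ∑ i, ψ ((r i : ℚ) • γ i) := by
      push_cast
      rw [Finset.mul_sum]
      refine Finset.sum_congr rfl fun i _ => ?_
      rw [hm, _root_.map_smul, smul_eq_mul]
      ring
    rw [h6, mul_zero] at h7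
    exact_mod_cast h7
  refine hΛY ?_
  rw [hYlog, map_sum]
  have h8 : ((∑ i, r i * m i : ℤ) : F) = 0 := by rw [h5, Int.cast_zero]
  rw [← h8, Int.cast_sum]
  refine Finset.sum_congr rfl fun i _ => ?_
  rw [← zsmul_eq_mul, map_zsmul, hr, zsmul_eq_mul, Int.cast_mul, mul_comm]

theorem IsExpPoly.differentiable {n : ℕ} {f : (Fin n → ℂ) → ℂ} (hf : IsExpPoly f) :
    Differentiable ℂ f := by
  induction hf with
  | proj i => exact differentiable_apply i
  | zero => exact differentiable_const 0
  | one => exact differentiable_const 1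
  | neg _ h => exact h.neg
  | add _ _ h1 h2 => exact h1.add h2
  | mul _ _ h1 h2 => exact h1.mul h2
  | exp _ h => exact h.cexp

theorem exists_tangent_of_not_expAlgebraic {ρ : ℂ} (hρ : ¬ ExpAlgebraic ρ) {N : ℕ}
    (p : Fin (N + 1) → ℂ) (hp : p 0 = ρ) :
    ∃ u : Fin (N + 1) → ℂ, u ≠ 0 ∧
      ∀ f : (Fin (N + 1) → ℂ) → ℂ, IsExpPoly f → f p = 0 → fderiv ℂ f p u = 0 := by
  classical
  let S : Set (Fin (N + 1) → ℂ) := {v | ∃ f : (Fin (N + 1) → ℂ) → ℂ, IsExpPoly f ∧ f p = 0 ∧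
    v = fun j => fderiv ℂ f p (Pi.single j 1)}
  by_cases hS : Submodule.span ℂ S = ⊤
  · exfalso
    obtain ⟨b, hbS, hbspan, hbli⟩ := exists_linearIndependent ℂ S
    rw [hS] at hbspan
    let B := Module.Basis.mk hbli (by rw [Subtype.range_coe, hbspan])
    let e : b ≃ Fin (N + 1) := B.indexEquiv (Pi.basisFun ℂ (Fin (N + 1)))
    choose f hf hf0 hfv using fun i : Fin (N + 1) => hbS (e.symm i).2
    refine hρ ⟨N + 1, N.succ_pos, p, f, hp, hf, hf0, ?_⟩
    have h1 : LinearIndependent ℂ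
        (Matrix.of fun i j => fderiv ℂ (f i) p (Pi.single j 1)).row := by
      have h2 := hbli.comp e.symm e.symm.injective
      convert! h2 using 1
      ext i j
      simp [hfv i]
    have h3 := Matrix.linearIndependent_rows_iff_isUnit.mp h1
    exact ((Matrix.isUnit_iff_isUnit_det _).mp h3).ne_zero
  · obtain ⟨f, hf0, hf⟩ := Submodule.exists_le_ker_of_lt_top _ (lt_top_iff_ne_top.mpr hS)
    have hfv : ∀ v, f v = ∑ i, v i * f (Pi.single i 1) := fun v => by
      conv_lhs => rw [pi_eq_sum_univ' v, map_sum]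
      refine Finset.sum_congr rfl fun i _ => ?_
      rw [map_smul, smul_eq_mul]
    refine ⟨fun i => f (Pi.single i 1), fun h => hf0 (LinearMap.ext fun v => ?_),
      fun g hg hg0 => ?_⟩
    · rw [hfv]; simp only [congrFun h]; simp
    · have h1 : f (fun j => fderiv ℂ g p (Pi.single j 1)) = 0 :=
        hf (Submodule.subset_span ⟨g, hg, hg0, rfl⟩)
      rw [hfv] at h1
      conv_lhs => rw [pi_eq_sum_univ' (fun i => f (Pi.single i 1)), map_sum]
      rw [← h1]
      refine Finset.sum_congr rfl fun i _ => ?_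
      rw [map_smul, smul_eq_mul, mul_comm]

/-- The ring of values of exponential polynomials at a point. -/
def expPolyValues {n : ℕ} (p : Fin n → ℂ) : Subring ℂ where
  carrier := {z | ∃ f : (Fin n → ℂ) → ℂ, IsExpPoly f ∧ f p = z}
  mul_mem' := by
    rintro _ _ ⟨f, hf, rfl⟩ ⟨g, hg, rfl⟩
    exact ⟨f * g, hf.mul hg, rfl⟩
  one_mem' := ⟨1, .one, rfl⟩
  add_mem' := by
    rintro _ _ ⟨f, hf, rfl⟩ ⟨g, hg, rfl⟩
    exact ⟨f + g, hf.add hg, rfl⟩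
  zero_mem' := ⟨0, .zero, rfl⟩
  neg_mem' := by
    rintro _ ⟨f, hf, rfl⟩
    exact ⟨-f, hf.neg, rfl⟩

theorem exists_derivation_expPolyValues {n : ℕ} (p u : Fin n → ℂ)
    (hu : ∀ f : (Fin n → ℂ) → ℂ, IsExpPoly f → f p = 0 → fderiv ℂ f p u = 0) :
    ∃ d : Derivation ℤ (expPolyValues p) ℂ,
      ∀ f (hf : IsExpPoly f), d ⟨f p, f, hf, rfl⟩ = fderiv ℂ f p u := by
  have hwd : ∀ f g : (Fin n → ℂ) → ℂ, IsExpPoly f → IsExpPoly g → f p = g p →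
      fderiv ℂ f p u = fderiv ℂ g p u := by
    intro f g hf hg h
    have h1 := hu (f + -g) (hf.add hg.neg) (by simp [h])
    rw [fderiv_add (hf.differentiable p) (hg.neg.differentiable p), fderiv_neg] at h1
    simpa [sub_eq_zero, ← sub_eq_add_neg] using h1
  choose F hF hFp using fun z : expPolyValues p => z.2
  have key : ∀ f (hf : IsExpPoly f) (z : expPolyValues p), f p = z →
      fderiv ℂ (F z) p u = fderiv ℂ f p u :=
    fun f hf z hz => hwd _ _ (hF _) hf ((hFp z).trans hz.symm)
  let d₀ : expPolyValues p →+ ℂ := AddMonoidHom.mk' (fun z => fderiv ℂ (F z) p u) fun x y => by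
    rw [key (F x + F y) ((hF x).add (hF y)) (x + y) (by simp [hFp]),
      fderiv_add ((hF x).differentiable p) ((hF y).differentiable p)]
    rfl
  refine ⟨Derivation.mk' d₀.toIntLinearMap fun x y => ?_, fun f hf => key f hf _ rfl⟩
  change fderiv ℂ (F (x * y)) p u = x • fderiv ℂ (F y) p u + y • fderiv ℂ (F x) p u
  rw [key (F x * F y) ((hF x).mul (hF y)) (x * y) (by simp [hFp]),
    fderiv_mul ((hF x).differentiable p) ((hF y).differentiable p), hFp, hFp]
  rfl

theorem exists_derivation_of_not_expAlgebraic {ρ : ℂ} (hρ : ¬ ExpAlgebraic ρ) {N : ℕ}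
    (p : Fin (N + 1) → ℂ) (hp : p 0 = ρ) (K : IntermediateField ℚ ℂ)
    (hK : ∀ x ∈ K, x ∈ Subfield.closure (expPolyValues p : Set ℂ)) (hpK : ∀ i, p i ∈ K) :
    ∃ D : Derivation ℚ K K, D ≠ 0 ∧ ∀ g : (Fin (N + 1) → ℂ) → ℂ, IsExpPoly g →
      ∀ (h : g p ∈ K) (h' : Complex.exp (g p) ∈ K),
        D ⟨Complex.exp (g p), h'⟩ = ⟨Complex.exp (g p), h'⟩ * D ⟨g p, h⟩ := by
  obtain ⟨u, hu0, hu⟩ := exists_tangent_of_not_expAlgebraic hρ p hp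
  obtain ⟨d, hd⟩ := exists_derivation_expPolyValues p u hu
  let R := expPolyValues p
  let T := Subfield.closure (R : Set ℂ)
  let ι : R →+* T := (algebraMap R ℂ).codRestrict T fun x => Subfield.subset_closure x.2
  let _ : Algebra R T := ι.toAlgebra
  have : IsScalarTower R T ℂ := IsScalarTower.of_algebraMap_eq fun _ => rfl
  have : FaithfulSMul R T := (faithfulSMul_iff_algebraMap_injective R T).mpr fun x y h =>
    Subtype.ext (congrArg (fun z : T => (z : ℂ)) h)
  have : IsFractionRing R T := IsFractionRing.of_field R T fun z => by
    obtain ⟨x, hx, y, hy, h⟩ := Subfield.mem_closure_iff.mp z.2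
    rw [Subring.closure_eq] at hx hy
    exact ⟨⟨x, hx⟩, ⟨y, hy⟩, Subtype.ext h.symm⟩
  have : Algebra.FormallyEtale R T := Algebra.FormallyEtale.of_isLocalization (nonZeroDivisors R)
  obtain ⟨d', hd'⟩ := Derivation.exists_extension_of_formallyEtale (T := T) d
  obtain ⟨j, hj⟩ := Function.ne_iff.mp hu0
  obtain ⟨φ, hφ⟩ : ∃ φ : ℂ →ₗ[K] K, φ (u j) ≠ 0 := by
    by_contra! h
    exact hj ((Module.forall_dual_apply_eq_zero_iff K (u j)).mp h)
  let D₀ : K →+ K := AddMonoidHom.mk' (fun x => φ (d' ⟨x, hK x x.2⟩)) fun x y => by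
    rw [← map_add, ← map_add]
    rfl
  have hval : ∀ f (hf : IsExpPoly f) (h : f p ∈ K), D₀ ⟨f p, h⟩ = φ (fderiv ℂ f p u) := by
    intro f hf h
    rw [← hd f hf, ← hd']
    rfl
  let D : Derivation ℚ K K := Derivation.mk' D₀.toRatLinearMap fun x y => by
    change φ (d' (⟨x, hK x x.2⟩ * ⟨y, hK y y.2⟩)) = x • D₀ y + y • D₀ x
    rw [d'.leibniz, map_add]
    have h : ∀ (x : K) (z : ℂ), (⟨x, hK x x.2⟩ : T) • z = x • z := fun _ _ => rfl
    rw [h, h, map_smul, map_smul]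
    rfl
  refine ⟨D, fun h0 => hφ ?_, fun g hg h h' => ?_⟩
  · have h1 := hval _ (.proj j) (hpK j)
    have h2 : D ⟨p j, hpK j⟩ = 0 := by rw [h0]; rfl
    have h3 : fderiv ℂ (fun x : Fin (N + 1) → ℂ => x j) p u = u j := by
      rw [(hasFDerivAt_apply j p).fderiv]; rfl
    rw [← h3, ← h1]
    exact h2
  · change D₀ _ = _ * D₀ _
    rw [hval _ hg.exp h', hval g hg h, (hg.differentiable p).hasFDerivAt.cexp.fderiv]
    change φ ((⟨Complex.exp (g p), h'⟩ : K) • fderiv ℂ g p u) = _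
    rw [map_smul, smul_eq_mul]

theorem trdeg_eq_algebra_trdeg (F E : Type*) [CommRing F] [CommRing E] [Algebra F E] :
    trdeg F E = Algebra.trdeg F E := rfl

theorem IntermediateField.trdeg_adjoin_le {F E : Type*} [Field F] [Field E] [Algebra F E]
    (T : Set E) : Algebra.trdeg F (adjoin F T) ≤ Cardinal.mk T := by
  let s : Set (adjoin F T) := Subtype.val ⁻¹' T
  have hs : Subtype.val '' s = T :=
    Set.image_preimage_eq_of_subset fun x hx => ⟨⟨x, subset_adjoin F T hx⟩, rfl⟩
  have htop : adjoin F s = ⊤ := by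
    apply IntermediateField.lift_injective (adjoin F T)
    rw [lift_adjoin, hs, lift_top]
  have : Algebra.IsAlgebraic (Algebra.adjoin F s) (adjoin F T) := ⟨fun x =>
    IntermediateField.isAlgebraic_adjoin_iff.mp
      (isAlgebraic_algebraMap (⟨x, htop ▸ mem_top⟩ : adjoin F s))⟩
  refine (Algebra.IsAlgebraic.trdeg_le_cardinalMk F s).trans ?_
  rw [← Cardinal.mk_image_eq Subtype.val_injective, hs]

theorem IntermediateField.trdeg_adjoin_union_le {F E : Type*} [Field F] [Field E] [Algebra F E]
    (S T : Set E) :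
    Algebra.trdeg F (adjoin F (S ∪ T)) ≤ Algebra.trdeg F (adjoin F S) + Cardinal.mk T := by
  rw [← adjoin_adjoin_left]
  change Algebra.trdeg F (adjoin (adjoin F S) T) ≤ _
  rw [← trdeg_add_eq F (adjoin F S)]
  gcongr
  exact trdeg_adjoin_le T

theorem exp_sum_int_mul {ι : Type*} [Fintype ι] {K : IntermediateField ℚ ℂ} (z y : ι → K)
    (hy : ∀ i, (y i : ℂ) = Complex.exp (z i)) (w : ι → ℤ) :
    ((∏ i, y i ^ w i : K) : ℂ) = Complex.exp (∑ i, w i * z i : K) := by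
  push_cast
  rw [Complex.exp_sum]
  refine Finset.prod_congr rfl fun i _ => ?_
  rw [Complex.exp_int_mul, ← hy]
  exact map_zpow₀ K.val _ _

theorem derivation_prod_zpow {ι K : Type*} [Fintype ι] [Field K] [Algebra ℚ K]
    (D : Derivation ℚ K K) (z y : ι → K) (hy0 : ∀ i, y i ≠ 0) (hD : ∀ i, D (y i) = y i * D (z i))
    (w : ι → ℤ) :
    D (∏ i, y i ^ w i) = (∏ i, y i ^ w i) * D (∑ i, w i * z i) := by
  have h0 : ∏ i, y i ^ w i ≠ 0 := Finset.prod_ne_zero_iff.mpr fun i _ => zpow_ne_zero _ (hy0 i)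
  rw [mul_comm, ← div_eq_iff h0,
    Derivation.map_prod_div_prod _ _ _ fun i _ => zpow_ne_zero _ (hy0 i), map_sum]
  refine Finset.sum_congr rfl fun i _ => ?_
  rw [Derivation.map_zpow_div _ (hy0 i), hD, mul_div_cancel_left₀ _ (hy0 i),
    ← zsmul_eq_mul, ← zsmul_eq_mul, map_zsmul]

theorem SchanuelConjecture.card_lt_trdeg (hSC : SchanuelConjecture) (K : IntermediateField ℚ ℂ)
    [Algebra.EssFiniteType ℚ K] (D : Derivation ℚ K K) (hD0 : D ≠ 0) {ι : Type*} [Fintype ι]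
    (z y : ι → K) (hz : LinearIndependent ℚ z) (hy : ∀ i, (y i : ℂ) = Complex.exp (z i))
    (hD : ∀ i, D (y i) = y i * D (z i)) :
    (Fintype.card ι : Cardinal) < Algebra.trdeg ℚ K := by
  have hy0 : ∀ i, y i ≠ 0 := fun i h => Complex.exp_ne_zero (z i) (by rw [← hy, h]; rfl)
  let T : (ι → ℚ) →ₗ[ℚ] K := Fintype.linearCombination ℚ (fun i => D (z i))
  have hT : ∀ (w : ι → ℤ) (q : ι → ℚ) (N : ℤ), (∀ i, (w i : ℚ) = N * q i) →
      D (∑ i, w i * z i) = (N : ℚ) • T q := by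
    intro w q N h
    rw [map_sum, Fintype.linearCombination_apply, Finset.smul_sum]
    refine Finset.sum_congr rfl fun i _ => ?_
    rw [← zsmul_eq_mul, map_zsmul, smul_smul, ← h, Int.cast_smul_eq_zsmul]
  let C := D.constants
  have hker : (Module.finrank ℚ (LinearMap.ker T) : Cardinal) ≤ Algebra.trdeg ℚ C := by
    let b := Module.finBasis ℚ (LinearMap.ker T)
    choose N w hN hw using fun s => exists_int_multiples (b s : ι → ℚ)
    let z' := fun s => (∑ i, w s i * z i : K)
    have hz'C : ∀ s, z' s ∈ C := fun s => by
      change D _ = 0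
      rw [hT _ _ _ (hw s), LinearMap.mem_ker.mp (b s).2, smul_zero]
    have hy'C : ∀ s, ∏ i, y i ^ w s i ∈ C := fun s => by
      change D _ = 0
      rw [derivation_prod_zpow D z y hy0 hD, Derivation.mem_constants.mp (hz'C s), mul_zero]
    have hli : LinearIndependent ℚ fun s => (z' s : ℂ) := by
      have h1 : LinearIndependent ℚ fun s => (b s : ι → ℚ) :=
        b.linearIndependent.map' (LinearMap.ker T).subtype (Submodule.ker_subtype _)
      have h2 := h1.map' (Fintype.linearCombination ℚ z)
        (LinearMap.ker_eq_bot.mpr hz.fintypeLinearCombination_injective)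
      have h3 := (h2.units_smul fun s => Units.mk0 (N s : ℚ) (Int.cast_ne_zero.mpr (hN s))).map'
        K.val.toLinearMap (LinearMap.ker_eq_bot.mpr K.val.injective)
      convert! h3 using 1
      ext s
      change _ = ((Units.mk0 (N s : ℚ) (Int.cast_ne_zero.mpr (hN s)) •
        Fintype.linearCombination ℚ z (b s) : K) : ℂ)
      congr 1
      rw [Units.smul_mk0, Fintype.linearCombination_apply, Finset.smul_sum]
      refine Finset.sum_congr rfl fun i _ => ?_
      rw [smul_smul, ← hw, Int.cast_smul_eq_zsmul, zsmul_eq_mul]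
    refine (hSC _ _ hli).trans ?_
    rw [trdeg_eq_algebra_trdeg]
    have hle : IntermediateField.adjoin ℚ (Set.range (fun s => (z' s : ℂ)) ∪
        Set.range fun s => Complex.exp (z' s)) ≤ IntermediateField.lift C := by
      rw [IntermediateField.adjoin_le_iff]
      rintro _ (⟨s, rfl⟩ | ⟨s, rfl⟩)
      · exact ⟨z' s, hz'C s, rfl⟩
      · exact ⟨_, hy'C s, exp_sum_int_mul z y hy (w s)⟩
    refine (trdeg_le_of_injective (IntermediateField.inclusion hle)
      (IntermediateField.inclusion_injective hle)).trans ?_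
    exact trdeg_le_of_injective (IntermediateField.liftAlgEquiv C).symm.toAlgHom
      (IntermediateField.liftAlgEquiv C).symm.injective
  have hrange : (Module.finrank ℚ (LinearMap.range T) : Cardinal) < Algebra.trdeg C K := by
    let b := Module.finBasis ℚ (LinearMap.range T)
    choose q hq using fun s => (b s).2
    choose N w hN hw using fun s => exists_int_multiples (q s)
    have : Algebra.EssFiniteType C K := Algebra.EssFiniteType.of_comp ℚ _ _
    have hDb : ∀ s, D (∑ i, w s i * z i) = (N s : ℚ) • (b s : K) := fun s => by
      rw [hT _ _ _ (hw s), hq]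
    refine D.overConstants.lt_trdeg_of_exponential (fun h => hD0 ?_) (fun x hx => ⟨⟨x, hx⟩, rfl⟩)
      (fun s => ∑ i, w s i * z i) (fun s => ∏ i, y i ^ w s i)
      (fun s => Finset.prod_ne_zero_iff.mpr fun i _ => zpow_ne_zero _ (hy0 i))
      (fun s => derivation_prod_zpow D z y hy0 hD (w s)) fun n hn => ?_
    · ext1 x
      exact congrArg (fun d : Derivation C K K => d x) h
    · have h1 : LinearIndependent ℚ fun s => (b s : K) :=
        b.linearIndependent.map' (LinearMap.range T).subtype (Submodule.ker_subtype _)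
      have h2 : ∑ s, (n s * N s : ℚ) • (b s : K) = 0 := by
        rw [← hn]
        refine Finset.sum_congr rfl fun s _ => ?_
        change _ = _ * D _
        rw [hDb, mul_smul, Int.cast_smul_eq_zsmul ℚ (n s), zsmul_eq_mul]
      ext s
      have h3 := Fintype.linearIndependent_iff.mp h1 _ h2 s
      exact_mod_cast (mul_eq_zero.mp h3).resolve_right (Int.cast_ne_zero.mpr (hN s))
  have hsum := LinearMap.finrank_range_add_finrank_ker T
  rw [Module.finrank_fintype_fun_eq_card] at hsum
  rw [← hsum, ← trdeg_add_eq ℚ C (A := K), ← Order.succ_le_iff, Cardinal.succ_natCast]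
  rw [← Order.succ_le_iff, Cardinal.succ_natCast] at hrange
  refine le_of_eq_of_le ?_ (add_le_add hker hrange)
  push_cast
  ring

theorem linearIndependent_of_multiplicatively_independent {n : ℕ} (a b α β : Fin n → ℂ)
    (ha : ∀ i, Complex.exp (α i) = a i) (hb : ∀ i, Complex.exp (β i) = b i)
    (hmi : ∀ m m' : Fin n → ℤ, (∏ i, a i ^ m i) * (∏ i, b i ^ m' i) = 1 → m = 0 ∧ m' = 0) :
    LinearIndependent ℚ (Sum.elim α β) := by
  rw [Fintype.linearIndependent_iff]
  intro q hq
  obtain ⟨N, m, hN, hm⟩ := exists_int_multiples q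
  have h1 : ∑ s, (m s : ℂ) * Sum.elim α β s = 0 := by
    have h2 := congrArg (fun x => (N : ℚ) • x) hq
    simp only [smul_zero, Finset.smul_sum, smul_smul, ← hm] at h2
    rw [← h2]
    refine Finset.sum_congr rfl fun s _ => ?_
    rw [Int.cast_smul_eq_zsmul, zsmul_eq_mul]
  have h3 := congrArg Complex.exp h1
  rw [Complex.exp_sum, Complex.exp_zero, Fintype.prod_sum_type] at h3
  simp only [Sum.elim_inl, Sum.elim_inr, Complex.exp_int_mul, ha, hb] at h3
  obtain ⟨h4, h5⟩ := hmi _ _ h3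
  intro s
  have h6 : m s = 0 := by
    cases s with
    | inl i => exact congrFun h4 i
    | inr i => exact congrFun h5 i
  have h7 := hm s
  rw [h6, Int.cast_zero] at h7
  exact (mul_eq_zero.mp h7.symm).resolve_left (Int.cast_ne_zero.mpr hN)

/-- **SC implies SCP_gen:** assuming Schanuel's conjecture, if `ρ` is not
exponentially algebraic in `ℂ_exp`, `bᵢ` is a value of `aᵢ^ρ` for each `i`, and the
`aᵢ, bᵢ` are multiplicatively independent, then `trdeg_ℚ(a₁, b₁, …, aₙ, bₙ) ≥ n`. -/
theorem sc_implies_scp_gen (hSC : SchanuelConjecture)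
    (ρ : ℂ) (hρ : ¬ ExpAlgebraic ρ) (n : ℕ) (a b : Fin n → ℂ)
    (hpow : ∀ i, ∃ α : ℂ, Complex.exp α = a i ∧ Complex.exp (ρ * α) = b i)
    (hmi : ∀ m m' : Fin n → ℤ,
      (∏ i, a i ^ m i) * (∏ i, b i ^ m' i) = 1 → m = 0 ∧ m' = 0) :
    (n : Cardinal) ≤ trdeg ℚ (IntermediateField.adjoin ℚ
      (Set.range a ∪ Set.range b)) := by
  choose α hαa hαb using hpow
  let p : Fin (n + 1) → ℂ := Fin.cons ρ α
  let K := IntermediateField.adjoin ℚ ((Set.range a ∪ Set.range b) ∪ Set.range p)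
  have : Algebra.EssFiniteType ℚ K := IntermediateField.essFiniteType_iff.mpr
    (IntermediateField.fg_adjoin_of_finite
      (((Set.finite_range a).union (Set.finite_range b)).union (Set.finite_range p)))
  have haK : ∀ i, a i ∈ K := fun i => IntermediateField.subset_adjoin _ _ (.inl (.inl ⟨i, rfl⟩))
  have hbK : ∀ i, b i ∈ K := fun i => IntermediateField.subset_adjoin _ _ (.inl (.inr ⟨i, rfl⟩))
  have hpK : ∀ i, p i ∈ K := fun i => IntermediateField.subset_adjoin _ _ (.inr ⟨i, rfl⟩)
  let g : Fin n ⊕ Fin n → (Fin (n + 1) → ℂ) → ℂ :=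
    Sum.elim (fun i x => x i.succ) fun i => (fun x => x 0) * fun x => x i.succ
  have hg : ∀ s, IsExpPoly (g s) := by
    rintro (i | i)
    · exact .proj _
    · exact .mul (.proj _) (.proj _)
  have hgp : ∀ s, g s p = Sum.elim α (fun i => ρ * α i) s := by rintro (i | i) <;> rfl
  have hexp : ∀ s, Complex.exp (g s p) = Sum.elim a b s := by
    rintro (i | i)
    · exact hαa i
    · exact hαb i
  have hgK : ∀ s, g s p ∈ K := by
    rintro (i | i)
    · exact hpK i.succ
    · exact mul_mem (hpK 0) (hpK i.succ)
  have hexpK : ∀ s, Complex.exp (g s p) ∈ K := by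
    intro s
    rw [hexp]
    rcases s with i | i
    · exact haK i
    · exact hbK i
  let T : IntermediateField ℚ ℂ :=
    (Subfield.closure (expPolyValues p : Set ℂ)).toIntermediateField fun q => by
      rw [eq_ratCast]; exact SubfieldClass.ratCast_mem _ q
  have hKT : K ≤ T := by
    have hT : ∀ f, IsExpPoly f → f p ∈ T := fun f hf => Subfield.subset_closure ⟨f, hf, rfl⟩
    rw [IntermediateField.adjoin_le_iff]
    rintro _ ((⟨i, rfl⟩ | ⟨i, rfl⟩) | ⟨i, rfl⟩)
    · rw [← hαa i]
      exact hT _ (hg (.inl i)).exp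
    · rw [← hαb i]
      exact hT _ (hg (.inr i)).exp
    · exact hT _ (.proj i)
  obtain ⟨D, hD0, hD⟩ := exists_derivation_of_not_expAlgebraic hρ p rfl K hKT hpK
  have hli : LinearIndependent ℚ fun s => (⟨g s p, hgK s⟩ : K) := by
    refine LinearIndependent.of_comp K.val.toLinearMap ?_
    convert! linearIndependent_of_multiplicatively_independent a b α _ hαa hαb hmi using 1
    exact funext hgp
  have hlt := hSC.card_lt_trdeg K D hD0 _ (fun s => ⟨Complex.exp (g s p), hexpK s⟩) hli
    (fun _ => rfl) fun s => hD (g s) (hg s) (hgK s) (hexpK s)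
  have hle : Algebra.trdeg ℚ K ≤
      Algebra.trdeg ℚ (IntermediateField.adjoin ℚ (Set.range a ∪ Set.range b)) +
        Cardinal.mk (Set.range p) := IntermediateField.trdeg_adjoin_union_le _ _
  have hcard : Cardinal.mk (Set.range p) ≤ (n + 1 : ℕ) := by
    simpa using Cardinal.mk_range_le (f := p)
  rw [trdeg_eq_algebra_trdeg]
  by_contra! hcon
  obtain ⟨t, ht⟩ := Cardinal.lt_aleph0.mp (hcon.trans Cardinal.natCast_lt_aleph0)
  rw [ht] at hcon hle
  have h1 := hlt.trans_le (hle.trans (add_le_add_right hcard _))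
  rw [Fintype.card_sum, Fintype.card_fin] at h1
  norm_cast at h1 hcon
  lia
end
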